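/- Let X be a normal locally noetherian scheme, U an open subscheme whose complement Z = X ∖ U has everywhere codimension at least 2 in X, and i : U → X the inclusion. If R is a reflexive coherent sheaf of O_X-modules, then the canonical morphism R → i_*(R|_U) (equivalently, the unit R → i_* i^* R of the adjunction) is an isomorphism. -/

import Mathlib

set_option linter.unusedVariables false
open CategoryTheory TopologicalSpace Opposite
universe u
variable {α : Type u} [TopologicalSpace α]

lemma map_map_apply (O : (Opens α)ᵒᵖ ⥤ CommRingCat.{u}) {A B C : Opens α}
    (h₁ : B ≤ A) (h₂ : C ≤ B) (r : O.obj (op A)) :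
    O.map (homOfLE h₂).op (O.map (homOfLE h₁).op r) = O.map (homOfLE (h₂.trans h₁)).op r := by
  rw [← comp_apply, ← O.map_comp]; rfl

lemma map_id_apply (O : (Opens α)ᵒᵖ ⥤ CommRingCat.{u}) {A : Opens α} (h : A ≤ A)
    (r : O.obj (op A)) : O.map (homOfLE h).op r = r := by
  rw [show (homOfLE h).op = 𝟙 (op A) from rfl, O.map_id]; rfl

structure OModuleOn (O : (Opens α)ᵒᵖ ⥤ CommRingCat.{u}) (U : Opens α) : Type (u + 1) where
  sec : ∀ (W : Opens α), W ≤ U → Type u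
  [secAddCommGroup : ∀ W hW, AddCommGroup (sec W hW)]
  [secModule : ∀ W hW, Module (O.obj (op W)) (sec W hW)]
  res : ∀ {W W' : Opens α} (hW : W ≤ U) (h : W' ≤ W), sec W hW → sec W' (h.trans hW)
  res_add : ∀ {W W'} (hW : W ≤ U) (h : W' ≤ W) (s t : sec W hW),
    res hW h (s + t) = res hW h s + res hW h t
  res_smul : ∀ {W W'} (hW : W ≤ U) (h : W' ≤ W) (r : O.obj (op W)) (s : sec W hW),
    res hW h (r • s) = O.map (homOfLE h).op r • res hW h s
  res_id : ∀ (W) (hW : W ≤ U) (s : sec W hW), res hW le_rfl s = s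
  res_comp : ∀ {W W' W''} (hW : W ≤ U) (h : W' ≤ W) (h' : W'' ≤ W') (s : sec W hW),
    res (h.trans hW) h' (res hW h s) = res hW (h'.trans h) s

attribute [instance] OModuleOn.secAddCommGroup OModuleOn.secModule

namespace OModuleOn
variable {O : (Opens α)ᵒᵖ ⥤ CommRingCat.{u}} {U : Opens α}

def resAddHom (F : OModuleOn O U) {W W' : Opens α} (hW : W ≤ U) (h : W' ≤ W) :
    F.sec W hW →+ F.sec W' (h.trans hW) :=
  AddMonoidHom.mk' (F.res hW h) (F.res_add hW h)

lemma res_zero (F : OModuleOn O U) {W W' : Opens α} (hW : W ≤ U) (h : W' ≤ W) :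
    F.res hW h (0 : F.sec W hW) = 0 := (F.resAddHom hW h).map_zero

lemma res_neg (F : OModuleOn O U) {W W' : Opens α} (hW : W ≤ U) (h : W' ≤ W) (s : F.sec W hW) :
    F.res hW h (-s) = -F.res hW h s := (F.resAddHom hW h).map_neg s

end OModuleOn

@[ext]
structure OModuleHom {O : (Opens α)ᵒᵖ ⥤ CommRingCat.{u}} {U : Opens α}
    (F G : OModuleOn O U) : Type u where
  app : ∀ (W : Opens α) (hW : W ≤ U), F.sec W hW → G.sec W hW
  app_add : ∀ W hW (s t : F.sec W hW), app W hW (s + t) = app W hW s + app W hW t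
  app_smul : ∀ W hW (r : O.obj (op W)) (s : F.sec W hW), app W hW (r • s) = r • app W hW s
  naturality : ∀ {W W'} (hW : W ≤ U) (h : W' ≤ W) (s : F.sec W hW),
    app W' (h.trans hW) (F.res hW h s) = G.res hW h (app W hW s)

namespace OModuleHom
variable {O : (Opens α)ᵒᵖ ⥤ CommRingCat.{u}} {U : Opens α} {F G : OModuleOn O U}

def IsIso (φ : OModuleHom F G) : Prop := ∀ W hW, Function.Bijective (φ.app W hW)

def appAddHom (φ : OModuleHom F G) (W : Opens α) (hW : W ≤ U) :
    F.sec W hW →+ G.sec W hW :=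
  AddMonoidHom.mk' (φ.app W hW) (φ.app_add W hW)

lemma app_zero (φ : OModuleHom F G) (W hW) : φ.app W hW 0 = 0 := (φ.appAddHom W hW).map_zero

lemma app_neg (φ : OModuleHom F G) (W hW) (s : F.sec W hW) :
    φ.app W hW (-s) = -φ.app W hW s := (φ.appAddHom W hW).map_neg s

instance : Zero (OModuleHom F G) :=
  ⟨{ app := fun W hW s => 0
     app_add := by intros; simp
     app_smul := by intros; simp
     naturality := by intros W W' hW h s; simp [G.res_zero] }⟩

instance : Add (OModuleHom F G) :=
  ⟨fun φ ψ =>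
    { app := fun W hW s => φ.app W hW s + ψ.app W hW s
      app_add := by intros W hW s t; rw [φ.app_add, ψ.app_add]; abel
      app_smul := by intros W hW r s; rw [φ.app_smul, ψ.app_smul, smul_add]
      naturality := by
        intros W W' hW h s
        rw [φ.naturality, ψ.naturality, G.res_add] }⟩

instance : Neg (OModuleHom F G) :=
  ⟨fun φ =>
    { app := fun W hW s => -φ.app W hW s
      app_add := by intros W hW s t; rw [φ.app_add]; abel
      app_smul := by intros W hW r s; rw [φ.app_smul, smul_neg]
      naturality := by
        intros W W' hW h s
        rw [φ.naturality, G.res_neg] }⟩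

@[simp] lemma zero_app (W hW) (s : F.sec W hW) : (0 : OModuleHom F G).app W hW s = 0 := rfl
@[simp] lemma add_app (φ ψ : OModuleHom F G) (W hW) (s : F.sec W hW) :
    (φ + ψ).app W hW s = φ.app W hW s + ψ.app W hW s := rfl
@[simp] lemma neg_app (φ : OModuleHom F G) (W hW) (s : F.sec W hW) :
    (-φ).app W hW s = -φ.app W hW s := rfl

instance : AddCommGroup (OModuleHom F G) := by
  refine
  { zero := 0, add := (· + ·), neg := Neg.neg
    add_assoc := ?_, zero_add := ?_, add_zero := ?_, neg_add_cancel := ?_,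
    add_comm := ?_, nsmul := nsmulRec, zsmul := zsmulRec } <;>
  · intros
    ext W hW s
    simp only [add_app, neg_app, zero_app]
    abel

instance : SMul (O.obj (op U)) (OModuleHom F G) :=
  ⟨fun r φ =>
    { app := fun W hW s => O.map (homOfLE hW).op r • φ.app W hW s
      app_add := by intros W hW s t; dsimp only; rw [φ.app_add, smul_add]
      app_smul := by
        intros W hW r' s; dsimp only
        rw [φ.app_smul, smul_smul, smul_smul, mul_comm]
      naturality := by
        intros W W' hW h s; dsimp only
        rw [G.res_smul, φ.naturality, map_map_apply] }⟩

@[simp] lemma smul_app (r : O.obj (op U)) (φ : OModuleHom F G) (W : Opens α) (hW : W ≤ U)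
    (s : F.sec W hW) : (r • φ).app W hW s = O.map (homOfLE hW).op r • φ.app W hW s := rfl

instance : Module (O.obj (op U)) (OModuleHom F G) where
  one_smul φ := by ext W hW s; simp
  mul_smul r r' φ := by ext W hW s; simp [map_mul, mul_smul]
  smul_zero r := by ext W hW s; simp
  smul_add r φ ψ := by ext W hW s; simp [smul_add]
  add_smul r r' φ := by ext W hW s; simp [map_add, add_smul]
  zero_smul φ := by ext W hW s; simp

end OModuleHom

namespace OModuleOn
variable {O : (Opens α)ᵒᵖ ⥤ CommRingCat.{u}} {U : Opens α}

/-- The restriction of a sheaf of modules on `U` to an open subset `V ≤ U`. -/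
def restrictTo (F : OModuleOn O U) {V : Opens α} (hV : V ≤ U) : OModuleOn O V where
  sec W hW := F.sec W (hW.trans hV)
  secAddCommGroup W hW := F.secAddCommGroup W _
  secModule W hW := F.secModule W _
  res hW h := F.res (hW.trans hV) h
  res_add hW h := F.res_add _ _
  res_smul hW h := F.res_smul _ _
  res_id W hW := F.res_id W _
  res_comp hW h h' := F.res_comp _ _ _

/-- The pushforward `i_* F` of a sheaf of modules on `U` along the inclusion `i : U → X`;
its sections over an open `V` are the sections of `F` over `U ⊓ V`. -/
def pushforward (F : OModuleOn O U) : OModuleOn O (⊤ : Opens α) where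
  sec V _ := F.sec (U ⊓ V) inf_le_left
  secAddCommGroup V _ := F.secAddCommGroup _ _
  secModule V _ := Module.compHom _ (O.map (homOfLE (inf_le_right : U ⊓ V ≤ V)).op).hom
  res {V V'} hV h := F.res inf_le_left (inf_le_inf_left U h)
  res_add hV h := F.res_add _ _
  res_smul {V V'} hV h r s := by
    show F.res inf_le_left (inf_le_inf_left U h)
        (O.map (homOfLE (inf_le_right : U ⊓ V ≤ V)).op r • s) = _
    rw [F.res_smul]
    show _ = O.map (homOfLE (inf_le_right : U ⊓ V' ≤ V')).op (O.map (homOfLE h).op r) •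
      F.res inf_le_left (inf_le_inf_left U h) s
    rw [map_map_apply, map_map_apply]
  res_id V hV s := F.res_id _ _ s
  res_comp hV h h' s := F.res_comp _ _ _ s

/-- The structure sheaf `O|_U`, viewed as a sheaf of modules over itself. -/
def unit (O : (Opens α)ᵒᵖ ⥤ CommRingCat.{u}) (U : Opens α) : OModuleOn O U where
  sec W _ := O.obj (op W)
  secAddCommGroup W _ := inferInstance
  secModule W _ := inferInstance
  res hW h s := O.map (homOfLE h).op s
  res_add hW h s t := map_add _ s t
  res_smul hW h r s := by
    dsimp only
    rw [smul_eq_mul, smul_eq_mul, map_mul]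
  res_id W hW s := map_id_apply O _ s
  res_comp hW h h' s := map_map_apply O _ _ s

/-- The sheaf `Hom` of two sheaves of modules on `U`: its sections over `W ≤ U` are the
morphisms `F|_W ⟶ G|_W`. -/
def sheafHom (F G : OModuleOn O U) : OModuleOn O U where
  sec W hW := OModuleHom (F.restrictTo hW) (G.restrictTo hW)
  secAddCommGroup W hW := inferInstance
  secModule W hW := inferInstance
  res {W W'} hW h φ :=
    { app := fun W'' h'' s => φ.app W'' (h''.trans h) s
      app_add := fun W'' h'' => φ.app_add W'' (h''.trans h)
      app_smul := fun W'' h'' => φ.app_smul W'' (h''.trans h)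
      naturality := fun h'' h''' s => φ.naturality (h''.trans h) h''' s }
  res_add hW h φ ψ := by ext W'' h'' s; rfl
  res_smul {W W'} hW h r φ := by
    ext W'' h'' s
    show O.map (homOfLE ((h''.trans h))).op r • φ.app W'' (h''.trans h) s =
      O.map (homOfLE h'').op (O.map (homOfLE h).op r) • φ.app W'' (h''.trans h) s
    rw [map_map_apply]
  res_id W hW φ := by ext W'' h'' s; rfl
  res_comp hW h h' φ := by ext W'' h'' s; rfl

/-- The dual of a sheaf of modules. -/
def dual (F : OModuleOn O U) : OModuleOn O U := sheafHom F (unit O U)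

/-- The bidual of a sheaf of modules. -/
def bidual (F : OModuleOn O U) : OModuleOn O U := dual (dual F)

end OModuleOn

namespace OModuleOn
variable {O : (Opens α)ᵒᵖ ⥤ CommRingCat.{u}} {U : Opens α}

/-- The evaluation of a section of `F` on sections of the dual of `F`. -/
def evalAt (F : OModuleOn O U) (W : Opens α) (hW : W ≤ U) (s : F.sec W hW) :
    OModuleHom ((dual F).restrictTo hW) ((unit O U).restrictTo hW) where
  app W' h' φ := φ.app W' le_rfl (F.res hW h' s)
  app_add W' h' φ ψ := rfl
  app_smul W' h' r φ := by
    show (r • φ).app W' le_rfl (F.res hW h' s) = r • φ.app W' le_rfl (F.res hW h' s)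
    erw [OModuleHom.smul_app, map_id_apply]
  naturality {W' W''} h' h'' φ := by
    show φ.app W'' h'' (F.res hW (h''.trans h') s) =
      O.map (homOfLE h'').op (φ.app W' le_rfl (F.res hW h' s))
    rw [← F.res_comp hW h' h'' s]
    exact φ.naturality (le_refl W') h'' (F.res hW h' s)

/-- The canonical morphism from a sheaf of modules to its bidual. -/
def evalHom (F : OModuleOn O U) : OModuleHom F (bidual F) where
  app W hW s := evalAt F W hW s
  app_add W hW s t := by
    apply OModuleHom.ext
    funext W' h' φ
    show φ.app W' le_rfl (F.res hW h' (s + t)) = _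
    rw [F.res_add]
    exact φ.app_add W' le_rfl _ _
  app_smul W hW r s := by
    apply OModuleHom.ext
    funext W' h' φ
    show φ.app W' le_rfl (F.res hW h' (r • s)) = _
    rw [F.res_smul]
    exact φ.app_smul W' le_rfl _ _
  naturality {W W'} hW h s := by
    apply OModuleHom.ext
    funext W'' h'' φ
    show φ.app W'' le_rfl (F.res (h.trans hW) h'' (F.res hW h s)) =
      φ.app W'' le_rfl (F.res hW (h''.trans h) s)
    rw [F.res_comp]

/-- A sheaf of modules is reflexive if the canonical morphism to its bidual
is an isomorphism. -/
def IsReflexive (F : OModuleOn O U) : Prop := (evalHom F).IsIso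

end OModuleOn

namespace OModuleOn
variable {O : (Opens α)ᵒᵖ ⥤ CommRingCat.{u}} {U : Opens α}

/-- The sections `s` generate `F` over `W`: every section of `F` on an open `W' ≤ W` is,
locally around each point, an `O`-linear combination of the restrictions of the `s i`. -/
def Generates (F : OModuleOn O U) {W : Opens α} (hW : W ≤ U) {n : ℕ}
    (s : Fin n → F.sec W hW) : Prop :=
  ∀ (W' : Opens α) (h : W' ≤ W) (t : F.sec W' (h.trans hW)), ∀ x ∈ W',
    ∃ (W'' : Opens α) (h' : W'' ≤ W'), x ∈ W'' ∧
      ∃ a : Fin n → O.obj (op W''),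
        F.res (h.trans hW) h' t = ∑ i, a i • F.res hW (h'.trans h) (s i)

/-- `F` is of finite type: locally generated by finitely many sections. -/
def IsFiniteType (F : OModuleOn O U) : Prop :=
  ∀ x ∈ U, ∃ (W : Opens α) (hW : W ≤ U), x ∈ W ∧
    ∃ (n : ℕ) (s : Fin n → F.sec W hW), F.Generates hW s

/-- The sheaf of relations between the finitely many sections `s` of `F` is locally
finitely generated. -/
def RelationsFiniteType (F : OModuleOn O U) {W : Opens α} (hW : W ≤ U) {n : ℕ}
    (s : Fin n → F.sec W hW) : Prop :=
  ∀ x ∈ W, ∃ (V : Opens α) (hVW : V ≤ W), x ∈ V ∧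
    ∃ (m : ℕ) (t : Fin m → (Fin n → O.obj (op V))),
      (∀ j, ∑ i, t j i • F.res hW hVW (s i) = 0) ∧
      ∀ (V' : Opens α) (h' : V' ≤ V) (a : Fin n → O.obj (op V')),
        (∑ i, a i • F.res hW (h'.trans hVW) (s i) = 0) →
        ∀ y ∈ V', ∃ (V'' : Opens α) (h'' : V'' ≤ V'), y ∈ V'' ∧
          ∃ c : Fin m → O.obj (op V''),
            ∀ i, O.map (homOfLE h'').op (a i) =
              ∑ j, c j * O.map (homOfLE (h''.trans h')).op (t j i)

/-- `F` is coherent: it is of finite type, and the sheaf of relations between any finitely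
many local sections is locally finitely generated. -/
def IsCoherent (F : OModuleOn O U) : Prop :=
  F.IsFiniteType ∧
    ∀ (W : Opens α) (hW : W ≤ U) (n : ℕ) (s : Fin n → F.sec W hW),
      F.RelationsFiniteType hW s

/-- `F` is torsion-free: on every open, the module of sections is torsion-free. -/
def IsTorsionFree (F : OModuleOn O U) : Prop :=
  ∀ (W : Opens α) (hW : W ≤ U) (r : O.obj (op W)) (s : F.sec W hW),
    r ∈ nonZeroDivisors (O.obj (op W)) → r • s = 0 → s = 0

/-- Two (pre)sheaves of modules are isomorphic. -/
def AreIsomorphic (F G : OModuleOn O U) : Prop :=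
  ∃ φ : OModuleHom F G, φ.IsIso

end OModuleOn

/-- The closed subset `T` of the topological space `S` has codimension at least two:
below every irreducible closed subset contained in `T` there is a chain of length two
of irreducible closed subsets of `S`. -/
def codimAtLeastTwo (S : Type*) [TopologicalSpace S] (T : Set S) : Prop :=
  ∀ C : TopologicalSpace.IrreducibleCloseds S, (C : Set S) ⊆ T → 2 ≤ Order.coheight C

/-- The subset `Z` of the topological space `X` has everywhere codimension at least two:
for every irreducible component `Y` of `X`, the codimension of `Z ∩ Y` in `Y` is
at least two. -/
def hasEverywhereCodimAtLeastTwo {X : Type*} [TopologicalSpace X] (Z : Set X) : Prop :=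
  ∀ Y ∈ irreducibleComponents X, codimAtLeastTwo Y (Subtype.val ⁻¹' Z)

/-- A (commutative, noetherian) local ring is regular if its maximal ideal is generated by
`dim R` many elements. -/
def IsRegularLocal (R : Type*) [CommRing R] [IsLocalRing R] : Prop :=
  IsNoetherianRing R ∧ ∃ (n : ℕ) (f : Fin n → R),
    Ideal.span (Set.range f) = IsLocalRing.maximalIdeal R ∧ (n : WithBot ℕ∞) = ringKrullDim R

/-- A commutative ring is regular if it is noetherian and all of its localizations at
prime ideals are regular local rings. -/
def IsRegularCommRing (R : Type*) [CommRing R] : Prop :=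
  IsNoetherianRing R ∧
    ∀ (P : Ideal R) [P.IsPrime], IsRegularLocal (Localization.AtPrime P)

open AlgebraicGeometry in
/-- A scheme is normal if all of its local rings are integrally closed domains. -/
def IsNormalScheme (X : Scheme) : Prop :=
  ∀ x : X, IsDomain (X.presheaf.stalk x) ∧ IsIntegrallyClosed (X.presheaf.stalk x)

open AlgebraicGeometry in
/-- A scheme is regular if all of its local rings are regular local rings. -/
def IsRegularScheme (X : Scheme) : Prop :=
  ∀ x : X, IsRegularLocal (X.presheaf.stalk x)

namespace OModuleOn
variable {O : (Opens α)ᵒᵖ ⥤ CommRingCat.{u}} {U : Opens α}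

/-- The sheaf condition (separation and gluing) for a presheaf of modules on `U`. -/
def IsSheaf (F : OModuleOn O U) : Prop :=
  ∀ (W : Opens α) (hW : W ≤ U) (S : Set (Opens α)) (hS : ∀ V ∈ S, V ≤ W), W ≤ sSup S →
    (∀ s : F.sec W hW, (∀ V (hV : V ∈ S), F.res hW (hS V hV) s = 0) → s = 0) ∧
    (∀ sf : ∀ V (hV : V ∈ S), F.sec V ((hS V hV).trans hW),
      (∀ V (hV : V ∈ S) (V' : Opens α) (hV' : V' ∈ S),
        F.res ((hS V hV).trans hW) (inf_le_left : V ⊓ V' ≤ V) (sf V hV) =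
        F.res ((hS V' hV').trans hW) (inf_le_right : V ⊓ V' ≤ V') (sf V' hV')) →
      ∃ s : F.sec W hW, ∀ V (hV : V ∈ S), F.res hW (hS V hV) s = sf V hV)

end OModuleOn

namespace OModuleOn
variable {O : (Opens α)ᵒᵖ ⥤ CommRingCat.{u}}

/-- The canonical morphism `R ⟶ i_* (R|_U)` (the unit of the adjunction), for a sheaf of
modules `R` on the whole space and an open subset `U`. -/
def restrictPushforwardUnit (R : OModuleOn O (⊤ : Opens α)) (U : Opens α) :
    OModuleHom R ((R.restrictTo (le_top : U ≤ ⊤)).pushforward) where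
  app V hV s := R.res hV (inf_le_right : U ⊓ V ≤ V) s
  app_add V hV s t := R.res_add hV inf_le_right s t
  app_smul V hV r s := R.res_smul hV inf_le_right r s
  naturality {V V'} hV h s := by
    show R.res (h.trans hV) inf_le_right (R.res hV h s) =
      R.res (le_top : U ⊓ V ≤ ⊤) (inf_le_inf_left U h) (R.res hV inf_le_right s)
    rw [R.res_comp, R.res_comp]

/-- The canonical comparison morphism `i_* Hom_{O_U}(i^* D, G) ⟶ Hom_{O_X}(D, i_* G)`. -/
def homPushforwardCompare (U : Opens α) (D : OModuleOn O (⊤ : Opens α)) (G : OModuleOn O U) :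
    OModuleHom ((sheafHom (D.restrictTo (le_top : U ≤ ⊤)) G).pushforward)
      (sheafHom D G.pushforward) where
  app V hV φ :=
    { app := fun W h d =>
        φ.app (U ⊓ W) (inf_le_inf_left U h) (D.res (h.trans hV) (inf_le_right : U ⊓ W ≤ W) d)
      app_add := fun W h d d' => by
        exact (congrArg (φ.app (U ⊓ W) (inf_le_inf_left U h))
          (D.res_add (h.trans hV) inf_le_right d d')).trans (φ.app_add _ _ _ _)
      app_smul := fun W h r d => by
        exact (congrArg (φ.app (U ⊓ W) (inf_le_inf_left U h))
          (D.res_smul (h.trans hV) inf_le_right r d)).trans (φ.app_smul _ _ _ _)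
      naturality := fun {W W'} h h' d => by
        show φ.app (U ⊓ W') (inf_le_inf_left U (h'.trans h))
            (D.res ((h'.trans h).trans hV) inf_le_right (D.res (h.trans hV) h' d)) =
          G.res inf_le_left (inf_le_inf_left U h')
            (φ.app (U ⊓ W) (inf_le_inf_left U h) (D.res (h.trans hV) inf_le_right d))
        refine (congrArg (φ.app (U ⊓ W') (inf_le_inf_left U (h'.trans h)))
          (D.res_comp (h.trans hV) h' inf_le_right d)).trans ?_
        have := φ.naturality (inf_le_inf_left U h) (inf_le_inf_left U h')
          (D.res (h.trans hV) inf_le_right d)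
        have h2 : ((D.restrictTo (le_top : U ≤ ⊤)).restrictTo
            (inf_le_left : U ⊓ V ≤ U)).res (inf_le_inf_left U h) (inf_le_inf_left U h')
            (D.res (h.trans hV) inf_le_right d) =
            D.res (h.trans hV) ((inf_le_inf_left U h').trans inf_le_right) d := by
          show D.res _ (inf_le_inf_left U h') (D.res (h.trans hV) inf_le_right d) = _
          exact D.res_comp _ _ _ d
        exact (congrArg (φ.app (U ⊓ W') (inf_le_inf_left U (h'.trans h))) h2.symm).trans this }
  app_add V hV φ ψ := by
    apply OModuleHom.ext
    funext W h d
    rfl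
  app_smul V hV r φ := by
    apply OModuleHom.ext
    funext W h d
    show O.map (homOfLE (inf_le_inf_left U h : U ⊓ W ≤ U ⊓ V)).op
        (O.map (homOfLE (inf_le_right : U ⊓ V ≤ V)).op r) •
        φ.app (U ⊓ W) (inf_le_inf_left U h) (D.res (h.trans hV) inf_le_right d) =
      O.map (homOfLE (inf_le_right : U ⊓ W ≤ W)).op (O.map (homOfLE h).op r) •
        φ.app (U ⊓ W) (inf_le_inf_left U h) (D.res (h.trans hV) inf_le_right d)
    rw [map_map_apply, map_map_apply]
  naturality {V V'} hV h φ := by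
    apply OModuleHom.ext
    funext W h' d
    show φ.app (U ⊓ W) ((inf_le_inf_left U h').trans (inf_le_inf_left U h))
        (D.res ((h'.trans h).trans hV) inf_le_right d) =
      φ.app (U ⊓ W) (inf_le_inf_left U (h'.trans h))
        (D.res ((h'.trans h).trans hV) inf_le_right d)
    rfl

end OModuleOn


open AlgebraicGeometry CategoryTheory

namespace HartogsAux

/-- In a noetherian normal domain, the denominators of a non-integral fraction are contained in
a prime ideal of height at most one. -/
lemma exists_height_le_one {A : Type*} [CommRing A] [IsDomain A] [IsNoetherianRing A]
    [IsIntegrallyClosed A] (a b : A) (hb : b ≠ 0) (hab : ¬ b ∣ a) :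
    ∃ p : PrimeSpectrum A, p.asIdeal.height ≤ 1 ∧ ∀ c, b ∣ c * a → c ∈ p.asIdeal := by
  have hx : Ideal.Quotient.mk (Ideal.span {b}) a ≠ 0 := by
    rwa [Ne, Ideal.Quotient.eq_zero_iff_mem, Ideal.mem_span_singleton]
  obtain ⟨p, hp, hle⟩ := exists_le_isAssociatedPrime_of_isNoetherianRing A
    (Ideal.Quotient.mk (Ideal.span {b}) a) hx
  rw [isAssociatedPrime_iff] at hp
  obtain ⟨hpp, c, hc⟩ := hp
  obtain ⟨c, rfl⟩ := Ideal.Quotient.mk_surjective c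
  have key : ∀ (x y : A), x ∈ (⊥ : Submodule A (A ⧸ Ideal.span {b})).colon
      {Ideal.Quotient.mk (Ideal.span {b}) y} ↔ b ∣ x * y := by
    intro x y
    rw [Submodule.mem_colon_singleton, Submodule.mem_bot, ← Ideal.mem_span_singleton,
      ← Ideal.Quotient.eq_zero_iff_mem, map_mul, Algebra.smul_def]
    rfl
  have hpc : ∀ x, x ∈ p ↔ b ∣ x * c := fun x => by rw [hc, key]
  refine ⟨⟨p, hpp⟩, ?_, fun d hd => hle ((key _ _).2 hd)⟩
  let K := FractionRing A
  have hbK : algebraMap A K b ≠ 0 := IsFractionRing.to_map_eq_zero_iff.not.mpr hb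
  let z : K := algebraMap A K c / algebraMap A K b
  obtain ⟨y, hy, w, hw, hyw⟩ : ∃ y ∈ p, ∃ w, w ∉ p ∧ y * c = b * w := by
    by_contra! hcon
    have hint : IsIntegral A z := by
      refine isIntegral_of_smul_mem_submodule (Submodule.map (Algebra.linearMap A K) p) ?_
        (Submodule.FG.map _ (IsNoetherian.noetherian _)) z ?_
      · rw [Submodule.ne_bot_iff]
        exact ⟨_, ⟨b, (hpc b).2 (dvd_mul_right _ _), rfl⟩, hbK⟩
      · rintro _ ⟨y, hy, rfl⟩
        obtain ⟨w, hw⟩ := (hpc y).1 hy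
        refine ⟨w, by_contra fun h => hcon y hy w h hw, ?_⟩
        have := congrArg (algebraMap A K) hw
        simp only [map_mul] at this
        simp only [Algebra.linearMap_apply, smul_eq_mul, z]
        rw [div_mul_eq_mul_div, eq_div_iff hbK]
        linear_combination -this
    obtain ⟨t, ht⟩ := IsIntegrallyClosed.algebraMap_eq_of_integral hint
    apply hpp.ne_top
    rw [Ideal.eq_top_iff_one, hpc, one_mul]
    refine ⟨t, IsFractionRing.injective A K ?_⟩
    rw [map_mul, ht]
    exact (mul_div_cancel₀ _ hbK).symm
  refine Ideal.height_le_one_of_isPrincipal_of_mem_minimalPrimes (Ideal.span {y}) p ?_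
  refine ⟨⟨hpp, (Ideal.span_singleton_le_iff_mem _).2 hy⟩, ?_⟩
  rintro q ⟨hq, hyq⟩ hqp x hx
  obtain ⟨v, hv⟩ := (hpc x).1 hx
  have hyq' : y ∈ q := (Ideal.span_singleton_le_iff_mem _).1 hyq
  have : w * x = y * v := by
    apply mul_left_cancel₀ hb
    linear_combination - x * hyw + y * hv
  exact (hq.mem_or_mem (this ▸ q.mul_mem_right v hyq' : w * x ∈ q)).resolve_left
    fun h => hw (hqp h)

section Formal
variable {α : Type u} [TopologicalSpace α] {O : (Opens α)ᵒᵖ ⥤ CommRingCat.{u}}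

lemma dual_res_bijective (U : Opens α)
    (hO : ∀ W : Opens α, Function.Bijective (O.map (homOfLE (inf_le_right : U ⊓ W ≤ W)).op))
    (D : OModuleOn O (⊤ : Opens α)) (V : Opens α) (hV : V ≤ ⊤) :
    Function.Bijective (D.dual.res hV (inf_le_right : U ⊓ V ≤ V)) := by
  constructor
  · intro φ ψ h
    apply OModuleHom.ext
    funext W hW d
    apply (hO W).1
    have hW' : U ⊓ W ≤ U ⊓ V := inf_le_inf_left U hW
    have h1 := φ.naturality hW (inf_le_right : U ⊓ W ≤ W) d
    have h2 := ψ.naturality hW (inf_le_right : U ⊓ W ≤ W) d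
    have h3 := congrFun (congrFun (congrFun (congrArg OModuleHom.app h) (U ⊓ W)) hW')
      (D.res (hW.trans hV) (inf_le_right : U ⊓ W ≤ W) d)
    exact h1.symm.trans (Eq.trans h3 h2)
  · intro ψ
    let g : ∀ (W : Opens α), O.obj (op (U ⊓ W)) → O.obj (op W) :=
      fun W => (Equiv.ofBijective _ (hO W)).symm
    have hg : ∀ W x, O.map (homOfLE (inf_le_right : U ⊓ W ≤ W)).op (g W x) = x :=
      fun W x => (Equiv.ofBijective _ (hO W)).apply_symm_apply x
    let r : ∀ (W : Opens α) (hW : W ≤ V), D.sec W (hW.trans hV) → O.obj (op (U ⊓ W)) :=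
      fun W hW d => ψ.app (U ⊓ W) (inf_le_inf_left U hW)
        (D.res (hW.trans hV) (inf_le_right : U ⊓ W ≤ W) d)
    refine ⟨
      { app := fun W hW d => g W (r W hW d)
        app_add := fun W hW d d' => ?_
        app_smul := fun W hW c d => ?_
        naturality := fun {W W'} hW h d => ?_ }, ?_⟩
    · apply (hO W).1
      refine Eq.trans ?_ (map_add _ _ _).symm
      rw [hg, hg, hg]
      exact (congrArg (ψ.app (U ⊓ W) (inf_le_inf_left U hW))
          (D.res_add (hW.trans hV) inf_le_right d d')).trans (ψ.app_add _ _ _ _)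
    · apply (hO W).1
      refine Eq.trans ?_ (map_mul _ _ _).symm
      rw [hg, hg]
      exact (congrArg (ψ.app (U ⊓ W) (inf_le_inf_left U hW))
          (D.res_smul (hW.trans hV) inf_le_right c d)).trans (ψ.app_smul _ _ _ _)
    · apply (hO W').1
      rw [hg]
      have e : O.map (homOfLE (inf_le_right : U ⊓ W' ≤ W')).op
          (O.map (homOfLE h).op (g W (r W hW d))) =
          O.map (homOfLE (inf_le_inf_left U h)).op (r W hW d) := by
        conv_rhs => rw [← hg W (r W hW d)]
        rw [map_map_apply, map_map_apply]
      refine Eq.trans ?_ e.symm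
      refine Eq.trans ?_ (ψ.naturality (inf_le_inf_left U hW) (inf_le_inf_left U h)
        (D.res (hW.trans hV) (inf_le_right : U ⊓ W ≤ W) d))
      refine congrArg (ψ.app (U ⊓ W') _) ?_
      exact (D.res_comp _ _ _ d).trans (D.res_comp _ _ _ d).symm
    · apply OModuleHom.ext
      funext W hW d
      apply (hO W).1
      refine (hg W _).trans ?_
      exact ψ.naturality hW (inf_le_right : U ⊓ W ≤ W) d

lemma unit_isIso (U : Opens α)
    (hO : ∀ W : Opens α, Function.Bijective (O.map (homOfLE (inf_le_right : U ⊓ W ≤ W)).op))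
    (R : OModuleOn O (⊤ : Opens α)) (hR : R.IsReflexive) :
    (R.restrictPushforwardUnit U).IsIso := by
  intro V hV
  have h1 : Function.Bijective (R.evalHom.app V hV) := hR V hV
  have h2 : Function.Bijective (R.evalHom.app (U ⊓ V) le_top) := hR (U ⊓ V) le_top
  have h3 : Function.Bijective (R.bidual.res hV (inf_le_right : U ⊓ V ≤ V)) :=
    dual_res_bijective U hO R.dual V hV
  refine (h2.of_comp_iff' _).1 ?_
  have e : R.evalHom.app (U ⊓ V) le_top ∘ (R.restrictPushforwardUnit U).app V hV =
      R.bidual.res hV (inf_le_right : U ⊓ V ≤ V) ∘ R.evalHom.app V hV := by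
    funext s
    exact R.evalHom.naturality hV (inf_le_right : U ⊓ V ≤ V) s
  rw [e]
  exact h3.comp h1

end Formal
end HartogsAux

namespace HartogsAux

lemma exists_good (X : Scheme.{u}) [IsLocallyNoetherian X] (hX : IsNormalScheme X)
    (W : X.Opens) (x : X) (hx : x ∈ W) :
    ∃ V : X.Opens, x ∈ V ∧ V ≤ W ∧ IsAffineOpen V ∧ IsNoetherianRing Γ(X, V) ∧
      IsDomain Γ(X, V) ∧ IsIntegrallyClosed Γ(X, V) := by
  obtain ⟨V, hxV, hV, hVW, hinj⟩ := X.exists_le_and_germ_injective x W hx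
  have := (hX x).1
  have hdom : IsDomain Γ(X, V) := hinj.isDomain (X.presheaf.germ V x hxV).hom
  refine ⟨V, hxV, hVW, hV, IsLocallyNoetherian.component_noetherian ⟨V, hV⟩, hdom, ?_⟩
  refine IsIntegrallyClosed.of_localization_maximal fun p _ hp => ?_
  let y : PrimeSpectrum Γ(X, V) := ⟨p, hp.isPrime⟩
  have hy : hV.fromSpec y ∈ V := by
    have : hV.fromSpec y ∈ Set.range hV.fromSpec := ⟨_, rfl⟩
    rwa [hV.range_fromSpec] at this
  let := TopCat.Presheaf.algebra_section_stalk X.presheaf (⟨hV.fromSpec y, hy⟩ : V)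
  have hl : IsLocalization.AtPrime (X.presheaf.stalk (hV.fromSpec y)) p :=
    hV.isLocalization_stalk' y hy
  have h2 := (hX (hV.fromSpec y)).2
  exact IsIntegrallyClosed.of_equiv (IsLocalization.algEquiv p.primeCompl
    (X.presheaf.stalk (hV.fromSpec y)) (Localization.AtPrime p)).toRingEquiv

lemma mem_of_height_le_one (X : Scheme.{u}) (U : X.Opens)
    (hZ : hasEverywhereCodimAtLeastTwo ((U : Set X)ᶜ)) (V : X.Opens) (hV : IsAffineOpen V)
    (p : PrimeSpectrum Γ(X, V)) (hp : p.asIdeal.height ≤ 1) : hV.fromSpec p ∈ U := by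
  by_contra hpU
  set y := hV.fromSpec p with hy
  let Y : Set X := irreducibleComponent y
  have hYc : IsClosed Y := isClosed_irreducibleComponent
  have hyY : y ∈ Y := mem_irreducibleComponent
  let y' : Y := ⟨y, hyY⟩
  let C : IrreducibleCloseds Y :=
    ⟨closure {y'}, isIrreducible_singleton.closure, isClosed_closure⟩
  have hC : (C : Set Y) ⊆ Subtype.val ⁻¹' ((U : Set X)ᶜ) := by
    refine closure_minimal ?_ ((U.isOpen.isClosed_compl).preimage continuous_subtype_val)
    rintro _ rfl
    exact hpU
  obtain ⟨l, hl, hlen⟩ := Order.exists_series_of_le_coheight (n := 2) C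
    (hZ Y (irreducibleComponent_mem_irreducibleComponents y) C hC)
  -- the generic points
  have gen : ∀ D : IrreducibleCloseds Y, C ≤ D → ∃ q : PrimeSpectrum Γ(X, V),
      closure {hV.fromSpec q} = Subtype.val '' (D : Set Y) := by
    intro D hD
    have hirr : IsIrreducible (Subtype.val '' (D : Set Y)) :=
      D.isIrreducible.image _ continuous_subtype_val.continuousOn
    have hcl : IsClosed (Subtype.val '' (D : Set Y)) :=
      hYc.isClosedEmbedding_subtypeVal.isClosedMap _ D.isClosed
    obtain ⟨z, hz⟩ := QuasiSober.sober hirr hcl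
    have hyD : y ∈ closure {z} := by
      rw [hz.def]
      exact ⟨y', hD (subset_closure rfl), rfl⟩
    have hzV : z ∈ V := by
      have hyV : y ∈ (V : Set X) := by
        rw [← hV.range_fromSpec]; exact ⟨p, rfl⟩
      exact (specializes_iff_mem_closure.2 hyD).mem_open V.isOpen hyV
    have : z ∈ Set.range hV.fromSpec := by rw [hV.range_fromSpec]; exact hzV
    obtain ⟨q, rfl⟩ := this
    exact ⟨q, hz.def⟩
  have mono : ∀ (D E : IrreducibleCloseds Y) (q r : PrimeSpectrum Γ(X, V)),
      closure {hV.fromSpec q} = Subtype.val '' (D : Set Y) →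
      closure {hV.fromSpec r} = Subtype.val '' (E : Set Y) → D < E → r < q := by
    intro D E q r hq hr hDE
    have hle : ∀ a b : PrimeSpectrum Γ(X, V),
        a ≤ b ↔ closure {hV.fromSpec b} ⊆ closure {hV.fromSpec a} := by
      intro a b
      rw [PrimeSpectrum.le_iff_specializes, ← specializes_iff_closure_subset]
      exact (hV.fromSpec.isOpenEmbedding.isInducing.specializes_iff).symm
    rw [lt_iff_le_not_ge, hle, hle, hq, hr, Set.image_subset_image_iff Subtype.val_injective,
      Set.image_subset_image_iff Subtype.val_injective]
    exact lt_iff_le_not_ge.1 hDE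
  let i0 : Fin (l.length + 1) := ⟨0, by omega⟩
  let i1 : Fin (l.length + 1) := ⟨1, by omega⟩
  let i2 : Fin (l.length + 1) := ⟨2, by omega⟩
  have hl0 : l i0 = C := hl
  have h01 : C < l i1 := hl0 ▸ l.strictMono (by simp [i0, i1, Fin.lt_def])
  have h12 : l i1 < l i2 := l.strictMono (by simp [i2, i1, Fin.lt_def])
  obtain ⟨q1, hq1⟩ := gen _ h01.le
  obtain ⟨q2, hq2⟩ := gen _ (h01.trans h12).le
  have hpC : closure {hV.fromSpec p} = Subtype.val '' (C : Set Y) := by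
    change _ = Subtype.val '' (closure {y'})
    rw [← hYc.isClosedEmbedding_subtypeVal.closure_image_eq, Set.image_singleton]
  have l1 := mono _ _ _ _ hpC hq1 h01
  have l2 := mono _ _ _ _ hq1 hq2 h12
  rw [PrimeSpectrum.height_eq_orderHeight] at hp
  have e1 := Order.height_add_one_le l1
  have e2 := Order.height_add_one_le l2
  have : (2 : ℕ∞) ≤ 1 := by
    calc (2 : ℕ∞) = 0 + 1 + 1 := by norm_num
      _ ≤ Order.height q2 + 1 + 1 := by gcongr; exact zero_le
      _ ≤ Order.height q1 + 1 := by gcongr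
      _ ≤ _ := e1
      _ ≤ 1 := hp
  exact absurd this (by norm_num)

end HartogsAux

namespace HartogsAux

section
variable {X : Scheme.{u}}

/-- Restriction of sections of the structure sheaf. -/
noncomputable def rs {V V' : X.Opens} (h : V' ≤ V) : Γ(X, V) →+* Γ(X, V') :=
  (X.presheaf.map (homOfLE h).op).hom

lemma rs_rs {V V' V'' : X.Opens} (h : V' ≤ V) (h' : V'' ≤ V') (s : Γ(X, V)) :
    rs h' (rs h s) = rs (h'.trans h) s :=
  map_map_apply X.presheaf h h' s

lemma eq_zero_of_locally {V : X.Opens} (s : Γ(X, V))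
    (H : ∀ x ∈ V, ∃ (V' : X.Opens) (h : V' ≤ V), x ∈ V' ∧ rs h s = 0) : s = 0 := by
  choose V' h hx h0 using H
  refine X.sheaf.eq_of_locally_eq' (fun x : V => V' x.1 x.2) V
    (fun x => homOfLE (h x.1 x.2)) ?_ s 0 ?_
  · intro x hxV
    exact Opens.mem_iSup.2 ⟨⟨x, hxV⟩, hx x hxV⟩
  · intro x
    exact (h0 x.1 x.2).trans (map_zero (rs (h x.1 x.2))).symm

lemma exists_fraction {V : X.Opens} (hV : IsAffineOpen V) (g : Γ(X, V))
    (f : Γ(X, X.basicOpen g)) : ∃ (m : ℕ) (c : Γ(X, V)),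
      rs (X.basicOpen_le g) (g ^ m) * f = rs (X.basicOpen_le g) c := by
  have := hV.isLocalization_basicOpen g
  obtain ⟨⟨c, ⟨_, m, rfl⟩⟩, h⟩ := IsLocalization.surj (Submonoid.powers g) f
  refine ⟨m, c, ?_⟩
  rw [mul_comm]
  exact h

lemma isUnit_rs {V : X.Opens} (g : Γ(X, V)) : IsUnit (rs (X.basicOpen_le g) g) :=
  RingedSpace.isUnit_res_basicOpen _ g

lemma rs_basicOpen_injective {V : X.Opens} (hV : IsAffineOpen V) [IsDomain Γ(X, V)]
    (g : Γ(X, V)) (hg : g ≠ 0) : Function.Injective (rs (X.basicOpen_le g)) := by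
  have := hV.isLocalization_basicOpen g
  exact IsLocalization.injective (M := Submonoid.powers g) Γ(X, X.basicOpen g)
    (powers_le_nonZeroDivisors_of_noZeroDivisors hg)

lemma sep {V : X.Opens} (hV : IsAffineOpen V) [IsDomain Γ(X, V)]
    (b : Γ(X, V)) (hb : b ≠ 0) {V' : X.Opens} (hV' : V' ≤ V) (hbV' : X.basicOpen b ≤ V')
    (f : Γ(X, V')) (hf : rs hbV' f = 0) : f = 0 := by
  apply eq_zero_of_locally
  intro x hx
  obtain ⟨g, hgV', hxg⟩ := hV.exists_basicOpen_le ⟨x, hx⟩ (hV' hx)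
  refine ⟨X.basicOpen g, hgV', hxg, ?_⟩
  have hg0 : g ≠ 0 := by
    rintro rfl
    rw [Scheme.basicOpen_zero] at hxg
    exact hxg
  obtain ⟨m, c, hc⟩ := exists_fraction hV g (rs hgV' f)
  have hmul : X.basicOpen (g * b) = X.basicOpen g ⊓ X.basicOpen b := Scheme.basicOpen_mul ..
  have hlg : X.basicOpen (g * b) ≤ X.basicOpen g := hmul ▸ inf_le_left
  have hlb : X.basicOpen (g * b) ≤ X.basicOpen b := hmul ▸ inf_le_right
  have hc0 : c = 0 := by
    apply rs_basicOpen_injective hV (g * b) (mul_ne_zero hg0 hb)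
    have h1 := congrArg (rs hlg) hc
    rw [map_mul, rs_rs, rs_rs, rs_rs, ← rs_rs hbV' hlb, hf, map_zero, mul_zero] at h1
    rw [map_zero, h1]
  rw [hc0, map_zero, map_pow] at hc
  exact (((isUnit_rs g).pow m).mul_right_eq_zero).1 hc

variable {U V : X.Opens}

lemma mem_basicOpen_iff (hV : IsAffineOpen V) (p : PrimeSpectrum Γ(X, V)) (g : Γ(X, V)) :
    hV.fromSpec p ∈ X.basicOpen g ↔ g ∉ p.asIdeal := by
  have := hV.fromSpec_preimage_basicOpen g
  change p ∈ hV.fromSpec ⁻¹ᵁ X.basicOpen g ↔ _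
  rw [this]
  exact PrimeSpectrum.mem_basicOpen _ _

lemma fromSpec_mem (hV : IsAffineOpen V) (p : PrimeSpectrum Γ(X, V)) : hV.fromSpec p ∈ V := by
  have : hV.fromSpec p ∈ Set.range hV.fromSpec := ⟨_, rfl⟩
  rwa [hV.range_fromSpec] at this

lemma exists_dense (hV : IsAffineOpen V) [IsDomain Γ(X, V)]
    (hU : ∀ p : PrimeSpectrum Γ(X, V), p.asIdeal.height ≤ 1 → hV.fromSpec p ∈ U) :
    ∃ b : Γ(X, V), b ≠ 0 ∧ X.basicOpen b ≤ U ⊓ V := by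
  let η : PrimeSpectrum Γ(X, V) := ⟨⊥, Ideal.isPrime_bot⟩
  have hη : hV.fromSpec η ∈ U := hU η (by simp [η])
  obtain ⟨b, hbU, hb⟩ := hV.exists_basicOpen_le (V := U ⊓ V)
    ⟨_, hη, fromSpec_mem hV η⟩ (fromSpec_mem hV η)
  exact ⟨b, (mem_basicOpen_iff hV η b).1 hb, hbU⟩

lemma good_injective (hV : IsAffineOpen V) [IsDomain Γ(X, V)]
    (hU : ∀ p : PrimeSpectrum Γ(X, V), p.asIdeal.height ≤ 1 → hV.fromSpec p ∈ U)
    (s : Γ(X, V)) (hs : rs (inf_le_right : U ⊓ V ≤ V) s = 0) : s = 0 := by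
  obtain ⟨b, hb, hbU⟩ := exists_dense hV hU
  refine sep hV b hb le_rfl (X.basicOpen_le b) s ?_
  rw [← rs_rs (inf_le_right : U ⊓ V ≤ V) hbU, hs, map_zero]

lemma good_surjective (hV : IsAffineOpen V) [IsDomain Γ(X, V)] [IsNoetherianRing Γ(X, V)]
    [IsIntegrallyClosed Γ(X, V)]
    (hU : ∀ p : PrimeSpectrum Γ(X, V), p.asIdeal.height ≤ 1 → hV.fromSpec p ∈ U)
    (s : Γ(X, (U ⊓ V : X.Opens))) : ∃ t : Γ(X, V), rs (inf_le_right : U ⊓ V ≤ V) t = s := by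
  obtain ⟨b, hb, hbU⟩ := exists_dense hV hU
  obtain ⟨m, a, ha⟩ := exists_fraction hV b (rs hbU s)
  have hbm : b ^ m ≠ 0 := pow_ne_zero _ hb
  have ha' : rs (inf_le_right : U ⊓ V ≤ V) (b ^ m) * s = rs inf_le_right a := by
    rw [← sub_eq_zero]
    refine sep hV b hb inf_le_right hbU _ ?_
    rw [map_sub, map_mul, rs_rs, rs_rs, ha, sub_self]
  have hdvd : b ^ m ∣ a := by
    by_contra hnd
    obtain ⟨p, hp, hpc⟩ := exists_height_le_one a (b ^ m) hbm hnd
    obtain ⟨g, hgU, hg⟩ := hV.exists_basicOpen_le (V := U ⊓ V)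
      ⟨_, hU p hp, fromSpec_mem hV p⟩ (fromSpec_mem hV p)
    rw [mem_basicOpen_iff] at hg
    obtain ⟨k, c, hc⟩ := exists_fraction hV g (rs hgU s)
    have hg0 : g ≠ 0 := by
      rintro rfl
      exact hg (zero_mem _)
    refine hg (p.isPrime.mem_of_pow_mem k (hpc _ ⟨c, ?_⟩))
    apply rs_basicOpen_injective hV g hg0
    have h1 := congrArg (rs hgU) ha'
    rw [map_mul, rs_rs, rs_rs] at h1
    rw [map_mul, map_mul, ← h1, ← hc]
    ring
  obtain ⟨t, rfl⟩ := hdvd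
  refine ⟨t, ?_⟩
  rw [← sub_eq_zero]
  refine sep hV b hb inf_le_right hbU _ ?_
  have h1 := congrArg (rs hbU) ha'
  rw [map_mul, rs_rs, rs_rs, map_mul, map_pow] at h1
  rw [map_sub, rs_rs, sub_eq_zero]
  exact (((isUnit_rs b).pow m).mul_left_cancel h1).symm

end

lemma hartogs (X : Scheme.{u}) [IsLocallyNoetherian X] (hX : IsNormalScheme X)
    (U : X.Opens) (hZ : hasEverywhereCodimAtLeastTwo ((U : Set X)ᶜ)) (W : X.Opens) :
    Function.Bijective (rs (inf_le_right : U ⊓ W ≤ W)) := by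
  have inj : ∀ W : X.Opens, Function.Injective (rs (inf_le_right : U ⊓ W ≤ W)) := by
    intro W
    rw [injective_iff_map_eq_zero]
    intro s hs
    apply eq_zero_of_locally
    intro x hx
    obtain ⟨V, hxV, hVW, hV, _, _, _⟩ := exists_good X hX W x hx
    refine ⟨V, hVW, hxV, good_injective hV (mem_of_height_le_one X U hZ V hV) _ ?_⟩
    rw [rs_rs, ← rs_rs (inf_le_right : U ⊓ W ≤ W) (inf_le_inf_left U hVW), hs, map_zero]
  refine ⟨inj W, fun s => ?_⟩
  have loc : ∀ x : W, ∃ (V : X.Opens) (hVW : V ≤ W) (t : Γ(X, V)), x.1 ∈ V ∧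
      rs (inf_le_right : U ⊓ V ≤ V) t = rs (inf_le_inf_left U hVW) s := by
    intro x
    obtain ⟨V, hxV, hVW, hV, _, _, _⟩ := exists_good X hX W x.1 x.2
    obtain ⟨t, ht⟩ := good_surjective hV (mem_of_height_le_one X U hZ V hV)
      (rs (inf_le_inf_left U hVW) s)
    exact ⟨V, hVW, t, hxV, ht⟩
  choose V hVW t hxV ht using loc
  have ht' : ∀ x (V' : X.Opens) (h : V' ≤ V x), rs (inf_le_right : U ⊓ V' ≤ V') (rs h (t x)) =
      rs (inf_le_inf_left U (h.trans (hVW x))) s := by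
    intro x V' h
    rw [rs_rs, ← rs_rs (inf_le_right : U ⊓ V x ≤ V x) (inf_le_inf_left U h), ht, rs_rs]
  obtain ⟨r', hr', -⟩ := X.sheaf.existsUnique_gluing' V W (fun x => homOfLE (hVW x))
    (fun x hx => Opens.mem_iSup.2 ⟨⟨x, hx⟩, hxV _⟩) t (by
      intro x y
      exact inj (V x ⊓ V y) ((ht' x _ inf_le_left).trans (ht' y _ inf_le_right).symm))
  obtain ⟨r, hr⟩ : ∃ r : Γ(X, W), ∀ x, rs (hVW x) r = t x := ⟨r', hr'⟩
  refine ⟨r, ?_⟩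
  rw [← sub_eq_zero]
  apply eq_zero_of_locally
  intro x hx
  have hxW : x ∈ W := hx.2
  refine ⟨U ⊓ V ⟨x, hxW⟩, inf_le_inf_left U (hVW _), ⟨hx.1, hxV _⟩, ?_⟩
  rw [map_sub, rs_rs, ← rs_rs (hVW ⟨x, hxW⟩) inf_le_right, hr, ht, sub_self]

end HartogsAux

/-- Let `X` be a normal locally noetherian scheme, `U` an open subscheme whose
complement `Z = X ∖ U` has everywhere codimension at least `2` in `X`, and `i : U → X` the
inclusion.  If `R` is a reflexive coherent sheaf of `O_X`-modules, then the canonical morphism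
`R → i_* (R|_U)` (the unit of the adjunction) is an isomorphism. -/
theorem reflexive_pushforward_restrict_unit_isIso
    (X : Scheme.{u}) [IsLocallyNoetherian X] (hXnormal : IsNormalScheme X)
    (U : X.Opens) (hZ : hasEverywhereCodimAtLeastTwo ((U : Set X)ᶜ))
    (R : OModuleOn X.presheaf (⊤ : TopologicalSpace.Opens X))
    (hRsheaf : R.IsSheaf) (hRrefl : R.IsReflexive) (hRcoh : R.IsCoherent) :
    (R.restrictPushforwardUnit U).IsIso :=
  HartogsAux.unit_isIso U (fun W => HartogsAux.hartogs X hXnormal U hZ W) R hRrefl
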